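/- arXiv:1709.00335 — 2 statements merged into one kernel-verified Lean document; each statement's English description precedes it below -/
import Mathlib

section
/- Let n be a natural number and let x be a complex number which is not an integer. Then Σ_{k=0}^{n} (−1)^k C(n,k) · C(n+k,k)/C(x+k,k) · H_k^{⟨2⟩}(x) = ((−1)^n/2) · (C(−x+n,n)/C(x+n,n)) · { [H_n^{⟨2⟩}(x) − H_n^{⟨2⟩}(−x)] + 4n/(x(x−n)²) + [H_n(x) − H_n(−x) − H_n((x−n)/2)] · [H_n(x) − H_n(−x) − H_n((x−n)/2) − 2(x+n)/(x(x−n))] }. -/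
open Finset

/-- Generalized harmonic number `H_n(x) = ∑_{k=1}^n 1/(x+k)`. -/
noncomputable def genH (n : ℕ) (x : ℂ) : ℂ := ∑ k ∈ Finset.range n, 1 / (x + (k + 1))

/-- Generalized second-order harmonic number `H_n^{⟨2⟩}(x) = ∑_{k=1}^n 1/(x+k)^2`. -/
noncomputable def genH2 (n : ℕ) (x : ℂ) : ℂ := ∑ k ∈ Finset.range n, 1 / (x + (k + 1)) ^ 2

/-- Generalized binomial coefficient `C(z,m) = (∏_{j=0}^{m-1} (z-j))/m!`. -/
noncomputable def cbinom (z : ℂ) (m : ℕ) : ℂ := (∏ j ∈ Finset.range m, (z - j)) / (m.factorial : ℂ)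

/-- The summand `(-1)^k C(n,k) C(n+k,k) / C(x+k,k)`. -/
noncomputable def binomTerm (n k : ℕ) (x : ℂ) : ℂ :=
  (-1 : ℂ) ^ k * (n.choose k : ℂ) * (((n + k).choose k : ℂ) / cbinom (x + k) k)

/-- The sum of `binomTerm n k x` over all `k ≤ n`. -/
noncomputable def binomSum (n : ℕ) (x : ℂ) : ℂ := ∑ k ∈ range (n + 1), binomTerm n k x

/-- The sum of `binomTerm n k x * genH2 k x` over all `k ≤ n`. -/
noncomputable def harmonicSum (n : ℕ) (x : ℂ) : ℂ :=
  ∑ k ∈ range (n + 1), binomTerm n k x * genH2 k x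

/-- The defect of `harmonicSum` from satisfying the recurrence of `binomSum`, up to a factor. -/
noncomputable def defectSum (n : ℕ) (x : ℂ) : ℂ :=
  ∑ k ∈ range (n + 1), (n + 1 + k) * binomTerm n k x / (x + (k + 1)) ^ 2

/-- The combination of first-order harmonic numbers whose consecutive sums are rational. -/
noncomputable def altHarmonic (n : ℕ) (x : ℂ) : ℂ :=
  genH n x - genH n (-x) - genH n ((x - n) / 2) + 1 / x - 2 / (x - n)

lemma add_natCast_ne_zero {x : ℂ} (hx : ∀ m : ℤ, x ≠ m) (k : ℕ) : x + k ≠ 0 := by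
  intro h
  apply hx (-k)
  push_cast
  linear_combination h

lemma sub_natCast_ne_zero {x : ℂ} (hx : ∀ m : ℤ, x ≠ m) (k : ℕ) : x - k ≠ 0 := by
  intro h
  apply hx k
  push_cast
  linear_combination h

lemma ne_zero_of_not_int {x : ℂ} (hx : ∀ m : ℤ, x ≠ m) : x ≠ 0 := by
  simpa using hx 0

lemma add_one_not_int {x : ℂ} (hx : ∀ m : ℤ, x ≠ m) (m : ℤ) : x + 1 ≠ m := by
  intro h
  apply hx (m - 1)
  push_cast
  linear_combination h

lemma cbinom_add_succ (x : ℂ) (k : ℕ) :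
    cbinom (x + (k + 1 : ℕ)) (k + 1) = cbinom (x + k) k * (x + (k + 1)) / (k + 1) := by
  have h : ∏ j ∈ range k, (x + ((k + 1 : ℕ) : ℂ) - ((j + 1 : ℕ) : ℂ))
      = ∏ j ∈ range k, (x + (k : ℂ) - j) :=
    prod_congr rfl fun j _ => by push_cast; ring
  unfold cbinom
  rw [prod_range_succ', h, Nat.factorial_succ]
  have h1 : (k + 1 : ℂ) ≠ 0 := Nat.cast_add_one_ne_zero k
  have h2 : (k.factorial : ℂ) ≠ 0 := Nat.cast_ne_zero.mpr k.factorial_ne_zero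
  push_cast
  field_simp
  ring

lemma cbinom_zero (x : ℂ) : cbinom x 0 = 1 := by simp [cbinom]

lemma cbinom_ne_zero {x : ℂ} (hx : ∀ m : ℤ, x ≠ m) (k : ℕ) : cbinom (x + k) k ≠ 0 := by
  induction k with
  | zero => simp [cbinom_zero]
  | succ k ih =>
    rw [cbinom_add_succ]
    have := add_natCast_ne_zero hx (k + 1)
    push_cast at this
    exact div_ne_zero (mul_ne_zero ih this) (Nat.cast_add_one_ne_zero k)

lemma cbinom_shift (x : ℂ) (k : ℕ) :
    cbinom (x + k) k * (x + (k + 1)) = (x + 1) * cbinom (x + 1 + k) k := by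
  induction k with
  | zero => simp [cbinom_zero]
  | succ k ih =>
    rw [cbinom_add_succ, cbinom_add_succ]
    push_cast
    linear_combination ((x + (k + 1 + 1)) / (k + 1)) * ih

lemma binomTerm_zero (n : ℕ) (x : ℂ) : binomTerm n 0 x = 1 := by simp [binomTerm, cbinom_zero]

lemma binomTerm_self_succ (n : ℕ) (x : ℂ) : binomTerm n (n + 1) x = 0 := by simp [binomTerm]

lemma choose_mul_choose_succ_right (n k : ℕ) :
    (n.choose (k + 1) : ℂ) * ((n + (k + 1)).choose (k + 1) : ℂ) * (k + 1) ^ 2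
      = (n - k) * (n + k + 1) * (n.choose k * (n + k).choose k) := by
  have h1 : (n.choose (k + 1) : ℂ) * (k + 1) = n.choose k * (n - k) := by
    rcases le_or_gt k n with h | h
    · have := Nat.choose_succ_right_eq n k
      rw [← Nat.cast_sub h]
      exact_mod_cast this
    · simp [Nat.choose_eq_zero_of_lt h, Nat.choose_eq_zero_of_lt (h.trans (Nat.lt_succ_self k))]
  have h2 : ((n + (k + 1)).choose (k + 1) : ℂ) * (k + 1) = (n + k + 1) * (n + k).choose k := by
    exact_mod_cast (Nat.add_one_mul_choose_eq (n + k) k).symm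
  linear_combination (((n + (k + 1)).choose (k + 1) : ℂ) * (k + 1)) * h1
    + (n.choose k * (n - k) : ℂ) * h2

lemma choose_mul_choose_succ_succ (n k : ℕ) :
    ((n + 1).choose (k + 1) : ℂ) * ((n + 1 + (k + 1)).choose (k + 1) : ℂ) * (k + 1) ^ 2
      = (n + k + 2) * (n + k + 1) * (n.choose k * (n + k).choose k) := by
  have h1 : ((n + 1).choose (k + 1) : ℂ) * (k + 1) = (n + 1) * n.choose k := by
    exact_mod_cast (Nat.add_one_mul_choose_eq n k).symm
  have h2 : ((n + 1 + (k + 1)).choose (k + 1) : ℂ) * (k + 1)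
      = (n + k + 2) * (n + k + 1).choose k := by
    have := (Nat.add_one_mul_choose_eq (n + k + 1) k).symm
    rw [show n + 1 + (k + 1) = n + k + 1 + 1 by ring]
    exact_mod_cast this
  have h3 : ((n + k + 1).choose k : ℂ) * (n + 1) = (n + k + 1) * (n + k).choose k := by
    have := Nat.choose_mul_succ_eq (n + k) k
    rw [show n + k + 1 - k = n + 1 by omega] at this
    have h4 : ((n + k).choose k : ℂ) * (n + k + 1) = (n + k + 1).choose k * (n + 1) := by
      exact_mod_cast this
    linear_combination -h4
  linear_combination (((n + 1 + (k + 1)).choose (k + 1) : ℂ) * (k + 1)) * h1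
    + ((n + 1) * n.choose k : ℂ) * h2 + ((n + k + 2) * n.choose k : ℂ) * h3

lemma binomTerm_succ_right {x : ℂ} (hx : ∀ m : ℤ, x ≠ m) (n k : ℕ) :
    binomTerm n (k + 1) x
      = -((n - k) * (n + k + 1) / ((k + 1) * (x + (k + 1)))) * binomTerm n k x := by
  have h1 := cbinom_ne_zero hx k
  have h2 := add_natCast_ne_zero hx (k + 1)
  push_cast at h2
  have h3 : (k + 1 : ℂ) ≠ 0 := Nat.cast_add_one_ne_zero k
  unfold binomTerm
  rw [cbinom_add_succ, pow_succ]
  field_simp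
  linear_combination -choose_mul_choose_succ_right n k

lemma binomTerm_succ_succ {x : ℂ} (hx : ∀ m : ℤ, x ≠ m) (n k : ℕ) :
    binomTerm (n + 1) (k + 1) x
      = -((n + k + 2) * (n + k + 1) / ((k + 1) * (x + (k + 1)))) * binomTerm n k x := by
  have h1 := cbinom_ne_zero hx k
  have h2 := add_natCast_ne_zero hx (k + 1)
  push_cast at h2
  have h3 : (k + 1 : ℂ) ≠ 0 := Nat.cast_add_one_ne_zero k
  unfold binomTerm
  rw [cbinom_add_succ, pow_succ]
  field_simp
  linear_combination -choose_mul_choose_succ_succ n k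

lemma binomTerm_succ_left {x : ℂ} (hx : ∀ m : ℤ, x ≠ m) (n k : ℕ) :
    (n + 1 - k) * binomTerm (n + 1) k x = (n + 1 + k) * binomTerm n k x := by
  cases k with
  | zero => simp [binomTerm_zero]
  | succ k =>
    rw [binomTerm_succ_succ hx, binomTerm_succ_right hx]
    push_cast
    ring

lemma binomTerm_shift {x : ℂ} (hx : ∀ m : ℤ, x ≠ m) (n k : ℕ) :
    binomTerm n k x / (x + (k + 1)) = binomTerm n k (x + 1) / (x + 1) := by
  have h := cbinom_shift x k
  have h1 := cbinom_ne_zero hx k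
  have h2 := cbinom_ne_zero (add_one_not_int hx) k
  have h3 := add_natCast_ne_zero hx (k + 1)
  have h4 := add_natCast_ne_zero hx 1
  push_cast at h3 h4
  unfold binomTerm
  rw [div_eq_div_iff h3 h4]
  field_simp
  linear_combination -((n.choose k : ℂ) * ((n + k).choose k : ℂ)) * h

/-- The telescoping relation between consecutive rows of `binomTerm`. -/
lemma binomTerm_telescope {x : ℂ} (hx : ∀ m : ℤ, x ≠ m) (n k : ℕ) :
    (x + (n + 1)) * binomTerm (n + 1) (k + 1) x - (x - (n + 1)) * binomTerm n (k + 1) x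
      = 2 * (n + 1 + (k + 1)) * binomTerm n (k + 1) x - 2 * (n + 1 + k) * binomTerm n k x := by
  have h2 := add_natCast_ne_zero hx (k + 1)
  push_cast at h2
  have h3 : (k + 1 : ℂ) ≠ 0 := Nat.cast_add_one_ne_zero k
  rw [binomTerm_succ_succ hx, binomTerm_succ_right hx]
  field_simp
  ring

lemma binomSum_succ {x : ℂ} (hx : ∀ m : ℤ, x ≠ m) (n : ℕ) :
    (x + (n + 1)) * binomSum (n + 1) x = (x - (n + 1)) * binomSum n x := by
  have key (m : ℕ) : ∑ k ∈ range (m + 1),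
      ((x + (n + 1)) * binomTerm (n + 1) k x - (x - (n + 1)) * binomTerm n k x)
        = 2 * (n + 1 + m) * binomTerm n m x := by
    induction m with
    | zero => simp [binomTerm_zero]; ring
    | succ m ih =>
      rw [sum_range_succ, ih, binomTerm_telescope hx]
      push_cast
      ring
  have h := key (n + 1)
  rw [binomTerm_self_succ, sum_sub_distrib, ← mul_sum, ← mul_sum,
    sum_range_succ (fun k => binomTerm n k x), binomTerm_self_succ] at h
  unfold binomSum
  linear_combination h

lemma harmonicSum_succ {x : ℂ} (hx : ∀ m : ℤ, x ≠ m) (n : ℕ) :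
    (x + (n + 1)) * harmonicSum (n + 1) x
      = (x - (n + 1)) * harmonicSum n x - 2 * defectSum n x := by
  have key (m : ℕ) : ∑ k ∈ range (m + 1),
      ((x + (n + 1)) * (binomTerm (n + 1) k x * genH2 k x)
        - (x - (n + 1)) * (binomTerm n k x * genH2 k x))
        = 2 * (n + 1 + m) * binomTerm n m x * genH2 m x
          - 2 * ∑ k ∈ range m, (n + 1 + k) * binomTerm n k x / (x + (k + 1)) ^ 2 := by
    induction m with
    | zero => simp [genH2]
    | succ m ih =>
      have hH : genH2 (m + 1) x = genH2 m x + 1 / (x + (m + 1)) ^ 2 := sum_range_succ _ _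
      rw [sum_range_succ, ih, sum_range_succ _ m, hH]
      push_cast
      linear_combination (genH2 m x + 1 / (x + (m + 1)) ^ 2) * binomTerm_telescope hx n m
  have h := key (n + 1)
  rw [binomTerm_self_succ, sum_sub_distrib, ← mul_sum, ← mul_sum,
    sum_range_succ (fun k => binomTerm n k x * genH2 k x), binomTerm_self_succ] at h
  unfold harmonicSum defectSum
  linear_combination h

lemma binomSum_eq {x : ℂ} (hx : ∀ m : ℤ, x ≠ m) (n : ℕ) :
    binomSum n x = (-1) ^ n * (cbinom (-x + n) n / cbinom (x + n) n) := by
  induction n with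
  | zero => simp [binomSum, binomTerm_zero, cbinom_zero]
  | succ n ih =>
    have h1 := cbinom_ne_zero hx n
    have h2 := add_natCast_ne_zero hx (n + 1)
    push_cast at h2
    have h3 : (n + 1 : ℂ) ≠ 0 := Nat.cast_add_one_ne_zero n
    apply mul_left_cancel₀ h2
    rw [binomSum_succ hx, ih, cbinom_add_succ, cbinom_add_succ, pow_succ]
    field_simp
    ring

lemma binomSum_shift {x : ℂ} (hx : ∀ m : ℤ, x ≠ m) (n : ℕ) :
    (x - n) * (x + (n + 1)) * binomSum n (x + 1) = x * (x + 1) * binomSum n x := by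
  induction n with
  | zero => simp [binomSum, binomTerm_zero]
  | succ n ih =>
    have h1 := add_natCast_ne_zero hx (n + 1)
    have h2 := binomSum_succ hx n
    have h3 := binomSum_succ (add_one_not_int hx) n
    push_cast at h1 ⊢
    apply mul_left_cancel₀ h1
    linear_combination (x + (n + 1)) * (x - (n + 1)) * h3 + (x - (n + 1)) * ih
      - x * (x + 1) * h2

lemma defectSum_succ {x : ℂ} (hx : ∀ m : ℤ, x ≠ m) (n : ℕ) :
    (x + (n + 2)) * defectSum (n + 1) x + (x - (n + 1)) * defectSum n x
      = (2 * n + 3) * binomSum (n + 1) (x + 1) / (x + 1) := by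
  have h : defectSum n x
      = ∑ k ∈ range (n + 1 + 1), (n + 1 + k) * binomTerm n k x / (x + (k + 1)) ^ 2 := by
    rw [sum_range_succ, binomTerm_self_succ]
    simp [defectSum]
  rw [h, defectSum, binomSum, mul_sum, mul_sum, mul_sum, sum_div, ← sum_add_distrib]
  refine sum_congr rfl fun k _ => ?_
  have h3 := add_natCast_ne_zero hx (k + 1)
  push_cast at h3 ⊢
  rw [mul_div_assoc (2 * (n : ℂ) + 3), ← binomTerm_shift hx, ← binomTerm_succ_left hx]
  field_simp
  ring

lemma sum_range_two_mul_add_one (f : ℕ → ℂ) (n : ℕ) :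
    ∑ i ∈ range (2 * n + 1), f i
      = ∑ k ∈ range n, f (2 * k + 1) + ∑ k ∈ range (n + 1), f (2 * k) := by
  induction n with
  | zero => simp
  | succ n ih =>
    rw [show 2 * (n + 1) + 1 = 2 * n + 1 + 1 + 1 by ring, sum_range_succ, sum_range_succ, ih,
      sum_range_succ (fun k => f (2 * k + 1)) n, sum_range_succ (fun k => f (2 * k)) (n + 1),
      show 2 * (n + 1) = 2 * n + 1 + 1 by ring]
    ring

lemma sum_inv_window (x : ℂ) (n : ℕ) :
    ∑ i ∈ range (2 * n + 1), 1 / (x - n + 1 + i)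
      = genH n x - genH n (-x) + 1 / x + 1 / (x + (n + 1)) - 1 / (x - n) := by
  induction n with
  | zero => simp [genH]
  | succ n ih =>
    have hH (y : ℂ) : genH (n + 1) y = genH n y + 1 / (y + (n + 1)) := sum_range_succ _ _
    have hshift : ∑ i ∈ range (2 * n + 1), 1 / (x - ((n + 1 : ℕ) : ℂ) + 1 + ((i + 1 : ℕ) : ℂ))
        = ∑ i ∈ range (2 * n + 1), 1 / (x - n + 1 + i) :=
      sum_congr rfl fun i _ => by push_cast; congr 1; ring
    have h1 : -x + (n + 1) = -(x - (n + 1)) := by ring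
    have h2 : x - ((n : ℂ) + 1) + 1 + (2 * n + 2) = x + (n + 1 + 1) := by ring
    have h3 : x - ((n : ℂ) + 1) + 1 + 0 = x - n := by ring
    rw [show 2 * (n + 1) + 1 = 2 * n + 1 + 1 + 1 by ring, sum_range_succ, sum_range_succ', hshift,
      ih, hH, hH, h1]
    push_cast
    rw [h2, h3, div_neg]
    ring

lemma altHarmonic_succ (x : ℂ) (n : ℕ) :
    altHarmonic (n + 1) x = -altHarmonic n x - 1 / (x + (n + 1)) - 1 / (x - (n + 1)) := by
  have hH (y : ℂ) : genH (n + 1) y = genH n y + 1 / (y + (n + 1)) := sum_range_succ _ _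
  have h := sum_range_two_mul_add_one (fun i => 1 / (x - n + 1 + i)) n
  rw [sum_inv_window] at h
  have hodd : genH n ((x - n) / 2)
      = 2 * ∑ k ∈ range n, 1 / (x - n + 1 + ((2 * k + 1 : ℕ) : ℂ)) := by
    rw [genH, mul_sum]
    refine sum_congr rfl fun k _ => ?_
    rw [show (x - n) / 2 + (k + 1) = (x - n + 1 + ((2 * k + 1 : ℕ) : ℂ)) / 2 by push_cast; ring,
      one_div_div]
    ring
  have heven : genH (n + 1) ((x - (n + 1 : ℕ)) / 2)
      = 2 * ∑ k ∈ range (n + 1), 1 / (x - n + 1 + ((2 * k : ℕ) : ℂ)) := by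
    rw [genH, mul_sum]
    refine sum_congr rfl fun k _ => ?_
    rw [show (x - (n + 1 : ℕ)) / 2 + (k + 1) = (x - n + 1 + ((2 * k : ℕ) : ℂ)) / 2 by
      push_cast; ring, one_div_div]
    ring
  have h1 : -x + (n + 1) = -(x - (n + 1)) := by ring
  unfold altHarmonic
  rw [hodd, heven, hH, hH, h1, div_neg]
  push_cast at h ⊢
  linear_combination 2 * h

lemma defectSum_eq {x : ℂ} (hx : ∀ m : ℤ, x ≠ m) (n : ℕ) :
    (x + (n + 1)) * defectSum n x
      = -x * binomSum n x * (altHarmonic n x + 1 / (x + (n + 1))) := by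
  have hx0 := ne_zero_of_not_int hx
  have hx1 := add_natCast_ne_zero hx 1
  push_cast at hx1
  induction n with
  | zero =>
    simp [defectSum, binomSum, altHarmonic, binomTerm_zero, genH]
    field_simp
    ring
  | succ n ih =>
    have h1 := add_natCast_ne_zero hx (n + 1)
    have h2 := add_natCast_ne_zero hx (n + 2)
    have h3 := sub_natCast_ne_zero hx (n + 1)
    have hd := defectSum_succ hx n
    have hs := binomSum_shift hx (n + 1)
    have hb := binomSum_succ hx n
    push_cast at h1 h2 h3 hs ⊢
    have hb' : binomSum n x = (x + (n + 1)) * binomSum (n + 1) x / (x - (n + 1)) := by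
      rw [hb]; field_simp
    have hs' : binomSum (n + 1) (x + 1)
        = x * (x + 1) * binomSum (n + 1) x / ((x - (n + 1)) * (x + (n + 2))) := by
      rw [eq_div_iff (mul_ne_zero h3 h2)]
      linear_combination hs
    have hu : defectSum n x
        = -x * binomSum n x * (altHarmonic n x + 1 / (x + (n + 1))) / (x + (n + 1)) := by
      rw [← ih]; field_simp
    rw [hu, hb', hs'] at hd
    rw [altHarmonic_succ, show (n + 1 + 1 : ℂ) = n + 2 by ring, eq_sub_of_add_eq hd]
    field_simp
    ring

lemma harmonicSum_eq {x : ℂ} (hx : ∀ m : ℤ, x ≠ m) (n : ℕ) :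
    harmonicSum n x
      = binomSum n x / 2 * (genH2 n x - genH2 n (-x) + altHarmonic n x ^ 2 - 1 / x ^ 2) := by
  have hx0 := ne_zero_of_not_int hx
  induction n with
  | zero =>
    simp [harmonicSum, altHarmonic, genH, genH2]
    right
    field_simp
    ring
  | succ n ih =>
    have hH (y : ℂ) : genH2 (n + 1) y = genH2 n y + 1 / (y + (n + 1)) ^ 2 := sum_range_succ _ _
    have h1 := add_natCast_ne_zero hx (n + 1)
    have h3 := sub_natCast_ne_zero hx (n + 1)
    have hb := binomSum_succ hx n
    push_cast at h1 h3
    have hb' : binomSum (n + 1) x = (x - (n + 1)) * binomSum n x / (x + (n + 1)) := by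
      rw [← hb]; field_simp
    have hu : defectSum n x
        = -x * binomSum n x * (altHarmonic n x + 1 / (x + (n + 1))) / (x + (n + 1)) := by
      rw [← defectSum_eq hx]; field_simp
    apply mul_left_cancel₀ h1
    rw [harmonicSum_succ hx, ih, hu, hb', hH, hH, altHarmonic_succ,
      show (-x + (n + 1)) ^ 2 = (x - (n + 1)) ^ 2 by ring]
    field_simp
    ring

theorem stmt0 (n : ℕ) (x : ℂ) (hx : ∀ m : ℤ, x ≠ (m : ℂ)) :
    ∑ k ∈ Finset.range (n + 1),
      (-1 : ℂ) ^ k * (n.choose k : ℂ) * (((n + k).choose k : ℂ) / cbinom (x + k) k) * genH2 k x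
    = ((-1 : ℂ) ^ n / 2) * (cbinom (-x + n) n / cbinom (x + n) n) *
      ((genH2 n x - genH2 n (-x)) + 4 * n / (x * (x - n) ^ 2)
        + (genH n x - genH n (-x) - genH n ((x - n) / 2)) *
          (genH n x - genH n (-x) - genH n ((x - n) / 2) - 2 * (x + n) / (x * (x - n)))) := by
  have hx0 := ne_zero_of_not_int hx
  have hxn := sub_natCast_ne_zero hx n
  have h := harmonicSum_eq hx n
  rw [binomSum_eq hx] at h
  refine h.trans ?_
  rw [mul_div_right_comm]
  congr 1
  unfold altHarmonic
  generalize genH n x - genH n (-x) - genH n ((x - n) / 2) = a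
  field_simp
  ring
end

section
/- Let n be a natural number and let x be a complex number which is not an integer. Then Σ_{k=0}^{n} (−1)^k C(n,k) · C(n+k,k)/C(x+k,k) · H_k(x)² = ((−1)^n/2) · (C(−x+n,n)/C(x+n,n)) · { H_n^{⟨2⟩}(x) − H_n^{⟨2⟩}(−x) + 2[H_n(x) + H_n(−x)]² − [H_n(x) − H_n(−x) − H_n((x−n)/2)] · [H_n(x) − H_n(−x) − H_n((x−n)/2) − 2(x+n)/(x(x−n))] − 4n/(x(x−n)²) }. -/
open Finset

/-- The hypergeometric term `(-1)^k C(n,k) C(n+k,k) / C(x+k,k)`. -/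
noncomputable def hypTerm (x : ℂ) (n k : ℕ) : ℂ :=
  (-1 : ℂ) ^ k * (n.choose k : ℂ) * (((n + k).choose k : ℂ) / cbinom (x + k) k)

/-- The product `∏_{j=1}^n (x-j)/(x+j)`. -/
noncomputable def prodRatio (n : ℕ) (x : ℂ) : ℂ :=
  ∏ j ∈ Finset.range n, (x - (j + 1)) / (x + (j + 1))

/-- The complex number `x` is not an integer. -/
def NotInt (x : ℂ) : Prop := ∀ m : ℤ, x ≠ (m : ℂ)

namespace NotInt

variable {x : ℂ}

lemma add_intCast_ne_zero (hx : NotInt x) (m : ℤ) : x + m ≠ 0 := by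
  intro h
  apply hx (-m)
  push_cast
  linear_combination h

lemma ne_zero (hx : NotInt x) : x ≠ 0 := by
  simpa using hx.add_intCast_ne_zero 0

lemma add_natCast_add_one_ne_zero (hx : NotInt x) (m : ℕ) : x + (m + 1) ≠ 0 := by
  have := hx.add_intCast_ne_zero (m + 1)
  push_cast at this
  exact this

lemma sub_natCast_ne_zero (hx : NotInt x) (m : ℕ) : x - m ≠ 0 := by
  have := hx.add_intCast_ne_zero (-m)
  push_cast at this
  rwa [← sub_eq_add_neg] at this

lemma neg (hx : NotInt x) : NotInt (-x) := by
  intro m h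
  apply hx (-m)
  push_cast
  linear_combination -h

lemma add_one (hx : NotInt x) : NotInt (x + 1) := by
  intro m h
  apply hx (m - 1)
  push_cast
  linear_combination h

end NotInt

lemma cbinom_add_natCast (x : ℂ) (k : ℕ) :
    cbinom (x + k) k = (∏ j ∈ Finset.range k, (x + (j + 1))) / (k.factorial : ℂ) := by
  unfold cbinom
  congr 1
  rw [← Finset.prod_range_reflect]
  refine Finset.prod_congr rfl fun j hj => ?_
  have hj' : j + 1 ≤ k := Finset.mem_range.mp hj
  rw [Nat.sub_sub, Nat.cast_sub (by omega)]
  push_cast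
  ring

lemma cbinom_add_natCast_ne_zero {x : ℂ} (hx : NotInt x) (k : ℕ) : cbinom (x + k) k ≠ 0 := by
  rw [cbinom_add_natCast]
  exact div_ne_zero (Finset.prod_ne_zero_iff.mpr fun j _ => hx.add_natCast_add_one_ne_zero j)
    (Nat.cast_ne_zero.mpr k.factorial_ne_zero)

lemma cbinom_add_natCast_succ (x : ℂ) (k : ℕ) :
    (k + 1) * cbinom (x + (k + 1 : ℕ)) (k + 1) = (x + (k + 1)) * cbinom (x + k) k := by
  rw [cbinom_add_natCast, cbinom_add_natCast, Finset.prod_range_succ, Nat.factorial_succ]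
  have h1 : (k.factorial : ℂ) ≠ 0 := Nat.cast_ne_zero.mpr k.factorial_ne_zero
  have h2 : (k + 1 : ℂ) ≠ 0 := Nat.cast_add_one_ne_zero k
  push_cast
  field_simp

lemma cbinom_div_cbinom (n : ℕ) (x : ℂ) :
    (-1) ^ n * (cbinom (-x + n) n / cbinom (x + n) n) = prodRatio n x := by
  have h1 : (n.factorial : ℂ) ≠ 0 := Nat.cast_ne_zero.mpr n.factorial_ne_zero
  rw [cbinom_add_natCast, cbinom_add_natCast, div_div_div_cancel_right₀ h1, prodRatio,
    Finset.prod_div_distrib, ← mul_div_assoc]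
  congr 1
  have h : (-1 : ℂ) ^ n = ∏ _j ∈ Finset.range n, (-1 : ℂ) := by simp
  rw [h, ← Finset.prod_mul_distrib]
  exact Finset.prod_congr rfl fun j _ => by ring

lemma choose_succ_mul_choose_succ (n k : ℕ) :
    ((k : ℂ) + 1) ^ 2 * (n.choose (k + 1) * (n + (k + 1)).choose (k + 1))
      = (n - k) * (n + k + 1) * (n.choose k * (n + k).choose k) := by
  have h1 : (n.choose (k + 1) : ℂ) * (k + 1) = n.choose k * (n - k) := by
    rcases le_or_gt k n with h | h
    · have := Nat.choose_succ_right_eq n k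
      rw [← Nat.cast_sub h]
      exact_mod_cast this
    · simp [Nat.choose_eq_zero_of_lt h, Nat.choose_eq_zero_of_lt (h.trans k.lt_succ_self)]
  have h2 : ((n : ℂ) + k + 1) * (n + k).choose k = (n + (k + 1)).choose (k + 1) * (k + 1) := by
    exact_mod_cast Nat.add_one_mul_choose_eq (n + k) k
  linear_combination ((n + (k + 1)).choose (k + 1) * (k + 1) : ℂ) * h1
    - (n.choose k * (n - k) : ℂ) * h2

lemma succ_choose_succ_mul_choose_succ (n k : ℕ) :
    ((k : ℂ) + 1) ^ 2 * ((n + 1).choose (k + 1) * (n + 1 + (k + 1)).choose (k + 1))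
      = (n + k + 1) * (n + k + 2) * (n.choose k * (n + k).choose k) := by
  have h1 : ((n : ℂ) + 1) * n.choose k = (n + 1).choose (k + 1) * (k + 1) := by
    exact_mod_cast Nat.add_one_mul_choose_eq n k
  have h2 : ((n : ℂ) + 1 + k + 1) * (n + 1 + k).choose k
      = (n + 1 + (k + 1)).choose (k + 1) * (k + 1) := by
    exact_mod_cast Nat.add_one_mul_choose_eq (n + 1 + k) k
  have h3 : ((n + 1 + k).choose k : ℂ) * (n + 1) = (n + k).choose k * (n + k + 1) := by
    have := Nat.choose_mul_succ_eq (n + k) k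
    rw [show n + k + 1 - k = n + 1 by omega, show n + k + 1 = n + 1 + k by omega] at this
    have h4 : ((n + k).choose k : ℂ) * (n + 1 + k) = (n + 1 + k).choose k * (n + 1) := by
      exact_mod_cast this
    linear_combination -h4
  linear_combination (-(n + 1 + (k + 1)).choose (k + 1) * (k + 1) : ℂ) * h1
    - ((n + 1) * n.choose k : ℂ) * h2 + (n + k + 2) * n.choose k * h3

lemma hypTerm_zero_right (x : ℂ) (n : ℕ) : hypTerm x n 0 = 1 := by
  simp [hypTerm, cbinom]

lemma hypTerm_eq_zero_of_lt (x : ℂ) {n k : ℕ} (h : n < k) : hypTerm x n k = 0 := by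
  simp [hypTerm, Nat.choose_eq_zero_of_lt h]

lemma hypTerm_succ_right {x : ℂ} (hx : NotInt x) (n k : ℕ) :
    (k + 1) * (x + (k + 1)) * hypTerm x n (k + 1) = -((n - k) * (n + k + 1)) * hypTerm x n k := by
  have hc := cbinom_add_natCast_ne_zero hx k
  have hc' := cbinom_add_natCast_ne_zero hx (k + 1)
  have hs := cbinom_add_natCast_succ x k
  have hb := choose_succ_mul_choose_succ n k
  have hk : (k + 1 : ℂ) ≠ 0 := Nat.cast_add_one_ne_zero k
  unfold hypTerm
  rw [pow_succ, mul_div_assoc', mul_div_assoc', mul_div_assoc', mul_div_assoc',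
    div_eq_div_iff hc' hc]
  apply mul_left_cancel₀ hk
  linear_combination -(-1 : ℂ) ^ k * (x + (k + 1)) * cbinom (x + k) k * hb
    + (n - k) * (n + k + 1) * (-1 : ℂ) ^ k * n.choose k * (n + k).choose k * hs

lemma hypTerm_succ_succ {x : ℂ} (hx : NotInt x) (n k : ℕ) :
    (k + 1) * (x + (k + 1)) * hypTerm x (n + 1) (k + 1)
      = -((n + k + 1) * (n + k + 2)) * hypTerm x n k := by
  have hc := cbinom_add_natCast_ne_zero hx k
  have hc' := cbinom_add_natCast_ne_zero hx (k + 1)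
  have hs := cbinom_add_natCast_succ x k
  have hb := succ_choose_succ_mul_choose_succ n k
  have hk : (k + 1 : ℂ) ≠ 0 := Nat.cast_add_one_ne_zero k
  unfold hypTerm
  rw [pow_succ, mul_div_assoc', mul_div_assoc', mul_div_assoc', mul_div_assoc',
    div_eq_div_iff hc' hc]
  apply mul_left_cancel₀ hk
  linear_combination -(-1 : ℂ) ^ k * (x + (k + 1)) * cbinom (x + k) k * hb
    + (n + k + 1) * (n + k + 2) * (-1 : ℂ) ^ k * n.choose k * (n + k).choose k * hs

/-- Shifting `x` by one divides the hypergeometric term by a linear factor. -/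
lemma hypTerm_div {x : ℂ} (hx : NotInt x) (n k : ℕ) :
    hypTerm x n k / (x + (k + 1)) = hypTerm (x + 1) n k / (x + 1) := by
  induction k with
  | zero => simp [hypTerm_zero_right]
  | succ k ih =>
    have h1 := hypTerm_succ_right hx n k
    have h2 := hypTerm_succ_right hx.add_one n k
    have a0 : x + 1 ≠ 0 := hx.add_one.ne_zero
    have a1 := hx.add_natCast_add_one_ne_zero k
    have a2 := hx.add_one.add_natCast_add_one_ne_zero k
    have hk : (k + 1 : ℂ) ≠ 0 := Nat.cast_add_one_ne_zero k
    have a3 := hx.add_natCast_add_one_ne_zero (k + 1)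
    rw [div_eq_div_iff a1 a0] at ih
    rw [div_eq_div_iff a3 a0]
    push_cast
    apply mul_left_cancel₀ (mul_ne_zero hk a1)
    linear_combination (x + 1) * h1 - (x + (k + 1)) * h2 - (n - k) * (n + k + 1) * ih

/-- Zeilberger-type recurrence for the hypergeometric term. -/
lemma hypTerm_recurrence {x : ℂ} (hx : NotInt x) (n k : ℕ) :
    (n + 1 + x) * hypTerm x (n + 1) (k + 1) + (n + 1 - x) * hypTerm x n (k + 1)
      = 2 * (n + k + 2) * hypTerm x n (k + 1) - 2 * (n + k + 1) * hypTerm x n k := by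
  have h1 := hypTerm_succ_right hx n k
  have h2 := hypTerm_succ_succ hx n k
  have hk : (k + 1 : ℂ) ≠ 0 := Nat.cast_add_one_ne_zero k
  have a1 := hx.add_natCast_add_one_ne_zero k
  apply mul_left_cancel₀ (mul_ne_zero hk a1)
  linear_combination (n + 1 + x) * h2 + ((n + 1 - x) - 2 * (n + k + 2)) * h1

/-- Weighted sum of hypergeometric terms. -/
noncomputable def hypSum (x : ℂ) (n : ℕ) (f : ℕ → ℂ) : ℂ :=
  ∑ k ∈ Finset.range (n + 1), hypTerm x n k * f k

lemma hypSum_zero (x : ℂ) (f : ℕ → ℂ) : hypSum x 0 f = f 0 := by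
  simp [hypSum, hypTerm_zero_right]

/-- Summation by parts applied to `hypTerm_recurrence`. -/
lemma hypSum_recurrence {x : ℂ} (hx : NotInt x) (n : ℕ) (f : ℕ → ℂ) :
    (n + 1 + x) * hypSum x (n + 1) f + (n + 1 - x) * hypSum x n f
      = hypSum x n fun k => 2 * (n + k + 1) * (f k - f (k + 1)) := by
  have partial_sum : ∀ N : ℕ,
      ∑ k ∈ Finset.range (N + 1),
        ((n + 1 + x) * hypTerm x (n + 1) k + (n + 1 - x) * hypTerm x n k) * f k
      = ∑ k ∈ Finset.range (N + 1), hypTerm x n k * (2 * (n + k + 1) * (f k - f (k + 1)))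
        + 2 * (n + N + 1) * hypTerm x n N * f (N + 1) := by
    intro N
    induction N with
    | zero =>
      simp only [zero_add, Finset.sum_range_one, hypTerm_zero_right]
      push_cast
      ring
    | succ N ih =>
      rw [Finset.sum_range_succ, ih, Finset.sum_range_succ _ (N + 1), hypTerm_recurrence hx]
      push_cast
      ring
  have extend : ∀ g : ℕ → ℂ,
      hypSum x n g = ∑ k ∈ Finset.range (n + 1 + 1), hypTerm x n k * g k := by
    intro g
    rw [Finset.sum_range_succ, hypTerm_eq_zero_of_lt x n.lt_succ_self, hypSum]
    ring
  have h := partial_sum (n + 1)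
  rw [hypTerm_eq_zero_of_lt x n.lt_succ_self] at h
  rw [extend f, extend, hypSum, Finset.mul_sum, Finset.mul_sum, ← Finset.sum_add_distrib]
  rw [mul_zero, zero_mul, add_zero] at h
  rw [← h]
  exact Finset.sum_congr rfl fun k _ => by ring

lemma genH_succ (n : ℕ) (x : ℂ) : genH (n + 1) x = genH n x + 1 / (x + (n + 1)) := by
  simp [genH, Finset.sum_range_succ]

lemma genH2_succ (n : ℕ) (x : ℂ) : genH2 (n + 1) x = genH2 n x + 1 / (x + (n + 1)) ^ 2 := by
  simp [genH2, Finset.sum_range_succ]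

lemma genH_add_one (n : ℕ) (x : ℂ) :
    genH n (x + 1) = genH n x + 1 / (x + (n + 1)) - 1 / (x + 1) := by
  induction n with
  | zero => simp [genH]
  | succ n ih =>
    rw [genH_succ, genH_succ, ih]
    push_cast
    ring

lemma genH_neg_add_one (n : ℕ) (x : ℂ) :
    genH n (-(x + 1)) = genH n (-x) - 1 / (n - x) - 1 / x := by
  induction n with
  | zero => simp [genH, div_neg]
  | succ n ih =>
    rw [genH_succ, genH_succ, ih]
    push_cast
    ring

lemma prodRatio_succ (n : ℕ) (x : ℂ) :
    prodRatio (n + 1) x = prodRatio n x * ((x - (n + 1)) / (x + (n + 1))) :=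
  Finset.prod_range_succ _ n

lemma prodRatio_add_one {x : ℂ} (hx : NotInt x) (n : ℕ) :
    prodRatio n (x + 1) / (x + 1) = prodRatio n x * (x / ((x - n) * (x + (n + 1)))) := by
  induction n with
  | zero =>
    have := hx.ne_zero
    have := hx.add_one.ne_zero
    simp [prodRatio]
    field_simp
  | succ n ih =>
    have a1 := hx.sub_natCast_ne_zero n
    have a2 := hx.sub_natCast_ne_zero (n + 1)
    have a3 := hx.add_natCast_add_one_ne_zero n
    have a4 := hx.add_natCast_add_one_ne_zero (n + 1)
    have a5 := hx.add_one.add_natCast_add_one_ne_zero n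
    push_cast at a2 a4
    rw [prodRatio_succ, prodRatio_succ, mul_div_right_comm, ih]
    push_cast
    field_simp
    ring

/-- The sum `∑ t(n,k)`, an instance of the Chu–Vandermonde identity. -/
lemma hypSum_one {x : ℂ} (hx : NotInt x) (n : ℕ) : hypSum x n (fun _ => 1) = prodRatio n x := by
  induction n with
  | zero => simp [hypSum_zero, prodRatio]
  | succ n ih =>
    have h := hypSum_recurrence hx n fun _ => 1
    have h0 : hypSum x n (fun k => 2 * (n + k + 1) * ((1 : ℂ) - 1)) = 0 := by simp [hypSum]
    have a := hx.add_natCast_add_one_ne_zero n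
    rw [h0, ih] at h
    rw [prodRatio_succ, ← mul_div_assoc, eq_div_iff a]
    linear_combination h

lemma hypSum_shift {x : ℂ} (hx : NotInt x) (n : ℕ) (f : ℕ → ℂ) :
    hypSum x n (fun k => f k / (x + (k + 1))) = hypSum (x + 1) n f / (x + 1) := by
  rw [hypSum, hypSum, Finset.sum_div]
  refine Finset.sum_congr rfl fun k _ => ?_
  rw [mul_div_assoc', mul_div_right_comm, hypTerm_div hx, mul_div_right_comm]

lemma hypSum_add (x : ℂ) (n : ℕ) (f g : ℕ → ℂ) :
    hypSum x n (fun k => f k + g k) = hypSum x n f + hypSum x n g := by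
  simp [hypSum, mul_add, Finset.sum_add_distrib]

lemma hypSum_const_mul (x : ℂ) (n : ℕ) (c : ℂ) (f : ℕ → ℂ) :
    hypSum x n (fun k => c * f k) = c * hypSum x n f := by
  rw [hypSum, hypSum, Finset.mul_sum]
  exact Finset.sum_congr rfl fun k _ => by ring

lemma hypSum_inv {x : ℂ} (hx : NotInt x) (n : ℕ) :
    hypSum x n (fun k => 1 / (x + (k + 1)))
      = prodRatio n x * (x / ((x - n) * (x + (n + 1)))) := by
  rw [hypSum_shift hx n fun _ => 1, hypSum_one hx.add_one, prodRatio_add_one hx]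

lemma hypSum_genH {x : ℂ} (hx : NotInt x) (n : ℕ) :
    hypSum x n (fun k => genH k x) = prodRatio n x * (genH n x + genH n (-x)) := by
  induction n with
  | zero => simp [hypSum_zero, genH]
  | succ n ih =>
    have h := hypSum_recurrence hx n fun k => genH k x
    have hr : hypSum x n (fun k => 2 * (n + k + 1) * (genH k x - genH (k + 1) x))
        = -2 * hypSum x n (fun _ => 1)
          + (-2 * (n - x)) * hypSum x n (fun k => 1 / (x + (k + 1))) := by
      rw [← hypSum_const_mul, ← hypSum_const_mul, ← hypSum_add]
      congr 1
      ext k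
      have a := hx.add_natCast_add_one_ne_zero k
      rw [genH_succ]
      field_simp
      ring
    rw [hr, ih, hypSum_one hx, hypSum_inv hx] at h
    have a := hx.add_natCast_add_one_ne_zero n
    have a1 := hx.sub_natCast_ne_zero n
    have a2 := hx.neg.add_natCast_add_one_ne_zero n
    have e : (x - (n + 1)) = -(-x + (n + 1)) := by ring
    apply mul_left_cancel₀ a
    rw [prodRatio_succ, genH_succ, genH_succ, e]
    have h' : (x + (n + 1)) * hypSum x (n + 1) (fun k => genH k x)
      = -2 * prodRatio n x
        + (-2 * (n - x)) * (prodRatio n x * (x / ((x - n) * (x + (n + 1)))))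
        - (-x + (n + 1)) * (prodRatio n x * (genH n x + genH n (-x))) := by
      linear_combination h
    rw [h']
    field_simp
    ring

/-- The step-two harmonic sum `H_n((x-n)/2) = ∑_{k=1}^n 2/(x-n+2k)`. -/
lemma genH_half (n : ℕ) (x : ℂ) :
    genH n ((x - n) / 2) = ∑ k ∈ Finset.range n, 2 / (x - n + 2 * (k + 1)) := by
  refine Finset.sum_congr rfl fun k _ => ?_
  rw [show (x - n) / 2 + ((k : ℂ) + 1) = (x - n + 2 * (k + 1)) / 2 by ring, one_div_div]

lemma genH_half_add_one (n : ℕ) (x : ℂ) :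
    genH (n + 1) ((x - (n + 1 : ℕ)) / 2) = genH n ((x + 1 - n) / 2) + 2 / (x - n + 1) := by
  rw [genH_half, genH_half, Finset.sum_range_succ']
  push_cast
  congr 1
  · exact Finset.sum_congr rfl fun k _ => by ring
  · ring

lemma genH_half_add_two (n : ℕ) (x : ℂ) :
    genH (n + 2) ((x - (n + 2 : ℕ)) / 2)
      = genH n ((x - n) / 2) + 2 / (x + n + 2) + 2 / (x - n) := by
  rw [genH_half, genH_half, Finset.sum_range_succ, Finset.sum_range_succ']
  push_cast
  rw [add_right_comm]
  congr 1
  · congr 1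
    · exact Finset.sum_congr rfl fun k _ => by ring
    · ring
  · ring

lemma genH_half_succ (n : ℕ) (x : ℂ) :
    genH (n + 1) ((x - (n + 1 : ℕ)) / 2)
      = -genH n ((x - n) / 2)
        + 2 * (1 / x + genH n x + 1 / (x + (n + 1)) - genH n (-x) - 1 / (x - n)) := by
  induction n with
  | zero =>
    rw [genH_half]
    simp [genH]
    ring
  | succ n ih =>
    rw [genH_half_add_two, ih, genH_succ, genH_succ,
      show -x + ((n : ℂ) + 1) = -(x - (n + 1)) by ring, div_neg]
    push_cast
    ring

/-- The sum `∑ t(n,k)/(x+k)`. -/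
lemma hypSum_inv_add {x : ℂ} (hx : NotInt x) (n : ℕ) :
    hypSum x n (fun k => 1 / (x + k))
      = prodRatio n x * (genH n ((x - n) / 2) + genH n (-x) - genH n x - 1 / x + 2 / (x - n)) := by
  induction n with
  | zero =>
    simp [hypSum_zero, prodRatio, genH]
    ring
  | succ n ih =>
    have h := hypSum_recurrence hx n fun k => 1 / (x + k)
    have hr : hypSum x n (fun k => 2 * (n + k + 1) * (1 / (x + k) - 1 / (x + (k + 1 : ℕ))))
        = (2 * (n + 1 - x)) * hypSum x n (fun k => 1 / (x + k))
          + (-2 * (n - x)) * hypSum x n (fun k => 1 / (x + (k + 1))) := by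
      rw [← hypSum_const_mul, ← hypSum_const_mul, ← hypSum_add]
      congr 1
      ext k
      have a := hx.add_natCast_add_one_ne_zero k
      have a' : x + k ≠ 0 := by simpa using hx.add_intCast_ne_zero k
      push_cast
      field_simp
      ring
    rw [hr, ih, hypSum_inv hx] at h
    have a := hx.add_natCast_add_one_ne_zero n
    have a0 := hx.ne_zero
    have a1 := hx.sub_natCast_ne_zero n
    have a2 := hx.neg.add_natCast_add_one_ne_zero n
    have e : (x - (n + 1)) = -(-x + (n + 1)) := by ring
    apply mul_left_cancel₀ a
    rw [prodRatio_succ, genH_half_succ, genH_succ, genH_succ]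
    push_cast
    rw [e]
    have h' := eq_sub_of_add_eq h
    rw [show (n + 1 + x : ℂ) = x + (n + 1) by ring] at h'
    rw [h']
    field_simp
    ring

/-- The sum `∑ t(n,k)/(x+k+1)²`. -/
lemma hypSum_inv_sq {x : ℂ} (hx : NotInt x) (n : ℕ) :
    hypSum x n (fun k => 1 / (x + (k + 1)) ^ 2)
      = prodRatio n x * (x / ((x - n) * (x + (n + 1))))
        * (genH (n + 1) ((x - (n + 1 : ℕ)) / 2) + genH n (-x) - genH n x
          - 1 / (n - x) - 1 / x - 1 / (x + (n + 1))) := by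
  have h := hypSum_shift hx n fun k => 1 / (x + 1 + k)
  rw [hypSum_inv_add hx.add_one, mul_div_right_comm, prodRatio_add_one hx, genH_add_one,
    genH_neg_add_one] at h
  rw [genH_half_add_one]
  convert h using 2
  · ext k
    rw [div_div, sq]
    ring_nf
  · ring

/-- The sum `∑ t(n,k) H_{k+1}(x)/(x+k+1)`. -/
lemma hypSum_genH_succ_div {x : ℂ} (hx : NotInt x) (n : ℕ) :
    hypSum x n (fun k => genH (k + 1) x / (x + (k + 1)))
      = prodRatio n x * (x / ((x - n) * (x + (n + 1))))
        * (genH n x + 1 / (x + (n + 1)) + genH n (-x) - 1 / (n - x) - 1 / x) := by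
  have h : (fun k => genH (k + 1) x) = fun k => 1 / (x + 1) * 1 + genH k (x + 1) := by
    ext k
    rw [genH_add_one, genH_succ]
    ring
  rw [hypSum_shift hx n fun k => genH (k + 1) x, h, hypSum_add, hypSum_const_mul,
    hypSum_one hx.add_one, hypSum_genH hx.add_one, genH_add_one, genH_neg_add_one,
    mul_comm (1 / (x + 1)), ← mul_add, mul_div_right_comm, prodRatio_add_one hx]
  ring

lemma hypSum_genH_sq {x : ℂ} (hx : NotInt x) (n : ℕ) :
    hypSum x n (fun k => genH k x ^ 2) = prodRatio n x / 2 *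
      (genH2 n x - genH2 n (-x)
        + 2 * (genH n x + genH n (-x)) ^ 2
        - (genH n x - genH n (-x) - genH n ((x - n) / 2)) *
          (genH n x - genH n (-x) - genH n ((x - n) / 2) - 2 * (x + n) / (x * (x - n)))
        - 4 * n / (x * (x - n) ^ 2)) := by
  induction n with
  | zero => simp [hypSum_zero, genH, genH2]
  | succ n ih =>
    have h := hypSum_recurrence hx n fun k => genH k x ^ 2
    have hr : hypSum x n (fun k => 2 * (n + k + 1) * (genH k x ^ 2 - genH (k + 1) x ^ 2))
        = -4 * hypSum x n (fun k => genH k x)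
          + (-2) * hypSum x n (fun k => 1 / (x + (k + 1)))
          + (-4 * (n - x)) * hypSum x n (fun k => genH (k + 1) x / (x + (k + 1)))
          + (2 * (n - x)) * hypSum x n (fun k => 1 / (x + (k + 1)) ^ 2) := by
      simp only [← hypSum_const_mul, ← hypSum_add]
      congr 1
      ext k
      have a := hx.add_natCast_add_one_ne_zero k
      rw [genH_succ]
      field_simp
      ring
    rw [hr, ih, hypSum_inv hx, hypSum_genH hx, hypSum_genH_succ_div hx, hypSum_inv_sq hx] at h
    have a := hx.add_natCast_add_one_ne_zero n
    have a0 := hx.ne_zero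
    have a1 := hx.sub_natCast_ne_zero n
    have a2 := hx.sub_natCast_ne_zero (n + 1)
    push_cast at a2
    apply mul_left_cancel₀ a
    have h' := eq_sub_of_add_eq h
    rw [show (n + 1 + x : ℂ) = x + (n + 1) by ring] at h'
    rw [h', genH_half_succ, prodRatio_succ, genH_succ, genH_succ, genH2_succ, genH2_succ,
      show -x + ((n : ℂ) + 1) = -(x - (n + 1)) by ring, show (n : ℂ) - x = -(x - n) by ring]
    push_cast
    generalize genH n ((x - n) / 2) = A
    generalize genH n x = p
    generalize genH n (-x) = q
    generalize genH2 n x = r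
    generalize genH2 n (-x) = s
    generalize prodRatio n x = P
    generalize (n : ℂ) = m at *
    field_simp
    ring

theorem stmt3 (n : ℕ) (x : ℂ) (hx : ∀ m : ℤ, x ≠ (m : ℂ)) :
    ∑ k ∈ Finset.range (n + 1),
      (-1 : ℂ) ^ k * (n.choose k : ℂ) * (((n + k).choose k : ℂ) / cbinom (x + k) k) *
        (genH k x) ^ 2
    = ((-1 : ℂ) ^ n / 2) * (cbinom (-x + n) n / cbinom (x + n) n) *
      (genH2 n x - genH2 n (-x)
        + 2 * (genH n x + genH n (-x)) ^ 2
        - (genH n x - genH n (-x) - genH n ((x - n) / 2)) *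
          (genH n x - genH n (-x) - genH n ((x - n) / 2) - 2 * (x + n) / (x * (x - n)))
        - 4 * n / (x * (x - n) ^ 2)) := by
  rw [div_mul_eq_mul_div, cbinom_div_cbinom]
  exact hypSum_genH_sq hx n
end
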